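/- arXiv:2510.00775 — 5 statements merged into one kernel-verified Lean document; each statement's English description precedes it below -/
import Mathlib

section
/- Under the surjectivity assumption on H^0(Q_2) → H^0(Q_3), the image of the degree-zero connecting homomorphism ∂⁰ : H^0(C_3) → H^1(C_1) arising from the long exact cohomology sequence of the middle column 0 → C_1 → C_2 → C_3 → 0 is contained in the subgroup S_1 = image(g_1 : H^1(C'_1) → H^1(C_1)). (This is the abstract homological form of Theorem 3.3(1) of the paper: for a short exact sequence of partially de Rham positive B-pairs, the connecting map H^0(W_3) → H^1(W_1) takes values in the partial Selmer group H^1_{g,J}(W_1).) -/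
open CategoryTheory HomologicalComplex

/-- Abstract homological form of Theorem 3.3(1): in a 3×3 degreewise short exact diagram of
cochain complexes of `R`-modules, assuming `H⁰(Q₂) → H⁰(Q₃)` is surjective, the image of the
connecting homomorphism `∂⁰ : H⁰(C₃) → H¹(C₁)` of the middle column is contained in
`S₁ = image (g₁ : H¹(C'₁) → H¹(C₁))`. -/
theorem stmt0 {R : Type} [CommRing R]
    (C'₁ C'₂ C'₃ C₁ C₂ C₃ Q₁ Q₂ Q₃ : CochainComplex (ModuleCat R) ℕ)
    (a₁ : C'₁ ⟶ C₁) (a₂ : C'₂ ⟶ C₂) (a₃ : C'₃ ⟶ C₃)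
    (b₁ : C₁ ⟶ Q₁) (b₂ : C₂ ⟶ Q₂) (b₃ : C₃ ⟶ Q₃)
    (p : C'₁ ⟶ C'₂) (q : C'₂ ⟶ C'₃)
    (u : C₁ ⟶ C₂) (v : C₂ ⟶ C₃)
    (r : Q₁ ⟶ Q₂) (s : Q₂ ⟶ Q₃)
    (wrow₁ : a₁ ≫ b₁ = 0) (wrow₂ : a₂ ≫ b₂ = 0) (wrow₃ : a₃ ≫ b₃ = 0)
    (hrow₁ : (ShortComplex.mk a₁ b₁ wrow₁).ShortExact)
    (hrow₂ : (ShortComplex.mk a₂ b₂ wrow₂).ShortExact)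
    (hrow₃ : (ShortComplex.mk a₃ b₃ wrow₃).ShortExact)
    (wcol' : p ≫ q = 0) (wcol : u ≫ v = 0) (wcolQ : r ≫ s = 0)
    (hcol' : (ShortComplex.mk p q wcol').ShortExact)
    (hcol : (ShortComplex.mk u v wcol).ShortExact)
    (hcolQ : (ShortComplex.mk r s wcolQ).ShortExact)
    (hsq₁ : a₁ ≫ u = p ≫ a₂) (hsq₂ : a₂ ≫ v = q ≫ a₃)
    (hsq₃ : b₁ ≫ r = u ≫ b₂) (hsq₄ : b₂ ≫ s = v ≫ b₃)
    (hsurj : Function.Surjective ⇑(homologyMap s 0)) :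
    ∀ x : C₃.homology 0, (hcol.δ 0 1 rfl) x ∈ Set.range ⇑(homologyMap a₁ 1) := by
  intro x
  let β : ShortComplex.mk u v wcol ⟶ ShortComplex.mk r s wcolQ :=
    { τ₁ := b₁, τ₂ := b₂, τ₃ := b₃, comm₁₂ := hsq₃, comm₂₃ := hsq₄ }
  have hnat : hcol.δ 0 1 rfl ≫ homologyMap b₁ 1 = homologyMap b₃ 0 ≫ hcolQ.δ 0 1 rfl :=
    HomologySequence.δ_naturality β hcol hcolQ 0 1 rfl
  have hδ : hcolQ.δ 0 1 rfl = 0 := by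
    have : Epi (homologyMap s 0) := (ModuleCat.epi_iff_surjective _).2 hsurj
    rw [← cancel_epi (homologyMap s 0), Limits.comp_zero]
    exact hcolQ.comp_δ 0 1 rfl
  rw [hδ, Limits.comp_zero] at hnat
  exact (ShortComplex.moduleCat_exact_iff _).1 (hrow₁.homology_exact₂ 1) _
    (ConcreteCategory.congr_hom hnat x)
end

section
/- Under the surjectivity assumption on H^0(Q_2) → H^0(Q_3), the assignment ∂¹ : S_3 → H^2(C'_1) defined by ∂¹(g_3(y)) := δ(y), where δ : H^1(C'_3) → H^2(C'_1) is the connecting homomorphism of the long exact cohomology sequence of the first column 0 → C'_1 → C'_2 → C'_3 → 0, is well-defined: if y, y' ∈ H^1(C'_3) satisfy g_3(y) = g_3(y') in H^1(C_3), then δ(y) = δ(y'). (This is the abstract homological form of Theorem 3.3(2) of the paper: the map ∂¹ : H^1_{g,J}(W_3) → H^2(W_1(δ)) given by choosing any preimage in H^1(W_3(δ)) is well-defined.) -/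
open CategoryTheory HomologicalComplex

/-- Abstract homological form of Theorem 3.3(2): in a 3×3 degreewise short exact diagram of
cochain complexes of `R`-modules, assuming `H⁰(Q₂) → H⁰(Q₃)` is surjective, the assignment
`∂¹ : S₃ → H²(C'₁)`, `∂¹(g₃(y)) := δ(y)` (with `δ` the connecting homomorphism of the first
column), is well-defined: if `g₃ y = g₃ y'` then `δ y = δ y'`. -/
theorem stmt1 {R : Type} [CommRing R]
    (C'₁ C'₂ C'₃ C₁ C₂ C₃ Q₁ Q₂ Q₃ : CochainComplex (ModuleCat R) ℕ)
    (a₁ : C'₁ ⟶ C₁) (a₂ : C'₂ ⟶ C₂) (a₃ : C'₃ ⟶ C₃)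
    (b₁ : C₁ ⟶ Q₁) (b₂ : C₂ ⟶ Q₂) (b₃ : C₃ ⟶ Q₃)
    (p : C'₁ ⟶ C'₂) (q : C'₂ ⟶ C'₃)
    (u : C₁ ⟶ C₂) (v : C₂ ⟶ C₃)
    (r : Q₁ ⟶ Q₂) (s : Q₂ ⟶ Q₃)
    (wrow₁ : a₁ ≫ b₁ = 0) (wrow₂ : a₂ ≫ b₂ = 0) (wrow₃ : a₃ ≫ b₃ = 0)
    (hrow₁ : (ShortComplex.mk a₁ b₁ wrow₁).ShortExact)
    (hrow₂ : (ShortComplex.mk a₂ b₂ wrow₂).ShortExact)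
    (hrow₃ : (ShortComplex.mk a₃ b₃ wrow₃).ShortExact)
    (wcol' : p ≫ q = 0) (wcol : u ≫ v = 0) (wcolQ : r ≫ s = 0)
    (hcol' : (ShortComplex.mk p q wcol').ShortExact)
    (hcol : (ShortComplex.mk u v wcol).ShortExact)
    (hcolQ : (ShortComplex.mk r s wcolQ).ShortExact)
    (hsq₁ : a₁ ≫ u = p ≫ a₂) (hsq₂ : a₂ ≫ v = q ≫ a₃)
    (hsq₃ : b₁ ≫ r = u ≫ b₂) (hsq₄ : b₂ ≫ s = v ≫ b₃)
    (hsurj : Function.Surjective ⇑(homologyMap s 0)) :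
    ∀ y y' : C'₃.homology 1, homologyMap a₃ 1 y = homologyMap a₃ 1 y' →
      (hcol'.δ 1 2 rfl) y = (hcol'.δ 1 2 rfl) y' := by
  intro y y' h
  obtain ⟨x, hx⟩ := (ShortComplex.moduleCat_exact_iff _).1 (hrow₃.homology_exact₁ 0 1 rfl)
    (y - y') (by simp [h])
  obtain ⟨x₂, rfl⟩ := hsurj x
  let φ : ShortComplex.mk a₂ b₂ wrow₂ ⟶ ShortComplex.mk a₃ b₃ wrow₃ :=
    { τ₁ := q, τ₂ := v, τ₃ := s, comm₁₂ := hsq₂.symm, comm₂₃ := hsq₄.symm }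
  have hlift : homologyMap q 1 (hrow₂.δ 0 1 rfl x₂) = y - y' :=
    (ConcreteCategory.congr_hom (HomologySequence.δ_naturality φ hrow₂ hrow₃ 0 1 rfl) x₂).trans hx
  have hδ := ConcreteCategory.congr_hom (hcol'.comp_δ 1 2 rfl) (hrow₂.δ 0 1 rfl x₂)
  rw [← sub_eq_zero, ← map_sub, ← hlift]
  exact hδ
end

section
/- Under the surjectivity assumption on H^0(Q_2) → H^0(Q_3), the sequence H^0(C_1) → H^0(C_2) → H^0(C_3) →^{∂⁰} S_1 → S_2 → S_3 →^{∂¹} H^2(C'_1) → H^2(C'_2) → H^2(C'_3) is exact, where: the maps between the H^0(C_i) and between the H^2(C'_i) are induced by the columns; ∂⁰ is the degree-zero connecting homomorphism of the middle column, corestricted to S_1; the maps S_i → S_{i+1} are the restrictions of the induced maps H^1(C_i) → H^1(C_{i+1}) (which carry S_i into S_{i+1}); and ∂¹ sends g_3(y) to the image of y under the connecting homomorphism H^1(C'_3) → H^2(C'_1) of the first column. (This is the abstract homological form of Theorem 3.3(3) of the paper: setting H^0_{g,J}(W) = H^0(W), H^1_{g,J}(W) and H^2_{g,J}(W) = H^2(W(δ)),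 one obtains a δ-functor on the category of J-de Rham positive B-pairs.) -/
open CategoryTheory HomologicalComplex

theorem ModuleCat.exact_apply_eq_zero_iff {R : Type} [CommRing R] {X Y Z : ModuleCat R}
    {f : X ⟶ Y} {g : Y ⟶ Z} {w : f ≫ g = 0} (h : (ShortComplex.mk f g w).Exact) (y : Y) :
    g y = 0 ↔ ∃ x : X, f x = y := by
  refine ⟨(ShortComplex.moduleCat_exact_iff _).1 h y, ?_⟩
  rintro ⟨x, rfl⟩
  rw [← ModuleCat.comp_apply, w]
  rfl

theorem ModuleCat.apply_apply_eq_of_comp_eq {R : Type} [CommRing R] {W X Y Z : ModuleCat R}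
    {f : W ⟶ X} {g : X ⟶ Z} {f' : W ⟶ Y} {g' : Y ⟶ Z} (h : f ≫ g = f' ≫ g') (x : W) :
    g (f x) = g' (f' x) := by
  rw [← ModuleCat.comp_apply, h, ModuleCat.comp_apply]

theorem homologyMap_apply_apply_of_comp_eq {R : Type} [CommRing R]
    {K L M N : CochainComplex (ModuleCat R) ℕ} {f : K ⟶ L} {g : L ⟶ N} {f' : K ⟶ M} {g' : M ⟶ N}
    (h : f ≫ g = f' ≫ g') (n : ℕ) (x : K.homology n) :
    homologyMap g n (homologyMap f n x) = homologyMap g' n (homologyMap f' n x) :=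
  ModuleCat.apply_apply_eq_of_comp_eq
    (by rw [← homologyMap_comp, ← homologyMap_comp, h]) x

/-- Abstract homological form of Theorem 3.3(3): in a 3×3 degreewise short exact diagram of
cochain complexes of `R`-modules, assuming `H⁰(Q₂) → H⁰(Q₃)` is surjective, the sequence
`H⁰(C₁) → H⁰(C₂) → H⁰(C₃) →∂⁰ S₁ → S₂ → S₃ →∂¹ H²(C'₁) → H²(C'₂) → H²(C'₃)` is exact,
where `Sᵢ = image(gᵢ : H¹(C'ᵢ) → H¹(Cᵢ))`, `∂⁰` is the degree-zero connecting map of the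
middle column (corestricted to `S₁`), the maps `Sᵢ → Sᵢ₊₁` are restrictions of the induced
maps on `H¹`, and `∂¹(g₃ y)` is the image of `y` under the connecting map of the first
column. All assertions are stated elementwise. -/
theorem stmt2 {R : Type} [CommRing R]
    (C'₁ C'₂ C'₃ C₁ C₂ C₃ Q₁ Q₂ Q₃ : CochainComplex (ModuleCat R) ℕ)
    (a₁ : C'₁ ⟶ C₁) (a₂ : C'₂ ⟶ C₂) (a₃ : C'₃ ⟶ C₃)
    (b₁ : C₁ ⟶ Q₁) (b₂ : C₂ ⟶ Q₂) (b₃ : C₃ ⟶ Q₃)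
    (p : C'₁ ⟶ C'₂) (q : C'₂ ⟶ C'₃)
    (u : C₁ ⟶ C₂) (v : C₂ ⟶ C₃)
    (r : Q₁ ⟶ Q₂) (s : Q₂ ⟶ Q₃)
    (wrow₁ : a₁ ≫ b₁ = 0) (wrow₂ : a₂ ≫ b₂ = 0) (wrow₃ : a₃ ≫ b₃ = 0)
    (hrow₁ : (ShortComplex.mk a₁ b₁ wrow₁).ShortExact)
    (hrow₂ : (ShortComplex.mk a₂ b₂ wrow₂).ShortExact)
    (hrow₃ : (ShortComplex.mk a₃ b₃ wrow₃).ShortExact)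
    (wcol' : p ≫ q = 0) (wcol : u ≫ v = 0) (wcolQ : r ≫ s = 0)
    (hcol' : (ShortComplex.mk p q wcol').ShortExact)
    (hcol : (ShortComplex.mk u v wcol).ShortExact)
    (hcolQ : (ShortComplex.mk r s wcolQ).ShortExact)
    (hsq₁ : a₁ ≫ u = p ≫ a₂) (hsq₂ : a₂ ≫ v = q ≫ a₃)
    (hsq₃ : b₁ ≫ r = u ≫ b₂) (hsq₄ : b₂ ≫ s = v ≫ b₃)
    (hsurj : Function.Surjective ⇑(homologyMap s 0)) :
    -- the maps H¹(Cᵢ) → H¹(Cᵢ₊₁) carry Sᵢ into Sᵢ₊₁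
    (∀ x ∈ Set.range ⇑(homologyMap a₁ 1), homologyMap u 1 x ∈ Set.range ⇑(homologyMap a₂ 1)) ∧
    (∀ x ∈ Set.range ⇑(homologyMap a₂ 1), homologyMap v 1 x ∈ Set.range ⇑(homologyMap a₃ 1)) ∧
    -- ∂⁰ takes values in S₁
    (∀ x : C₃.homology 0, (hcol.δ 0 1 rfl) x ∈ Set.range ⇑(homologyMap a₁ 1)) ∧
    -- ∂¹ is well-defined on S₃
    (∀ y y' : C'₃.homology 1, homologyMap a₃ 1 y = homologyMap a₃ 1 y' →
      (hcol'.δ 1 2 rfl) y = (hcol'.δ 1 2 rfl) y') ∧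
    -- exactness at H⁰(C₂)
    (∀ x : C₂.homology 0, (homologyMap v 0 x = 0 ↔ ∃ w : C₁.homology 0, homologyMap u 0 w = x)) ∧
    -- exactness at H⁰(C₃)
    (∀ x : C₃.homology 0, ((hcol.δ 0 1 rfl) x = 0 ↔ ∃ w : C₂.homology 0, homologyMap v 0 w = x)) ∧
    -- exactness at S₁
    (∀ x ∈ Set.range ⇑(homologyMap a₁ 1),
      (homologyMap u 1 x = 0 ↔ ∃ w : C₃.homology 0, (hcol.δ 0 1 rfl) w = x)) ∧
    -- exactness at S₂
    (∀ x ∈ Set.range ⇑(homologyMap a₂ 1),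
      (homologyMap v 1 x = 0 ↔ ∃ w ∈ Set.range ⇑(homologyMap a₁ 1), homologyMap u 1 w = x)) ∧
    -- exactness at S₃
    (∀ y : C'₃.homology 1,
      ((hcol'.δ 1 2 rfl) y = 0 ↔
        ∃ x ∈ Set.range ⇑(homologyMap a₂ 1), homologyMap v 1 x = homologyMap a₃ 1 y)) ∧
    -- exactness at H²(C'₁)
    (∀ z : C'₁.homology 2,
      (homologyMap p 2 z = 0 ↔ ∃ y : C'₃.homology 1, (hcol'.δ 1 2 rfl) y = z)) ∧
    -- exactness at H²(C'₂)
    (∀ z : C'₂.homology 2,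
      (homologyMap q 2 z = 0 ↔ ∃ w : C'₁.homology 2, homologyMap p 2 w = z)) := by
  have hau := homologyMap_apply_apply_of_comp_eq hsq₁
  have hav := homologyMap_apply_apply_of_comp_eq hsq₂
  have ex₁ := fun x => ModuleCat.exact_apply_eq_zero_iff (hrow₁.homology_exact₂ 1) x
  have exδ₃ := fun x => ModuleCat.exact_apply_eq_zero_iff (hrow₃.homology_exact₁ 0 1 rfl) x
  have exδ₂ := fun x => ModuleCat.exact_apply_eq_zero_iff (hrow₂.homology_exact₁ 0 1 rfl) x
  have ex' := fun n x => ModuleCat.exact_apply_eq_zero_iff (hcol'.homology_exact₂ n) x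
  have ex'₁ := fun x => ModuleCat.exact_apply_eq_zero_iff (hcol'.homology_exact₁ 1 2 rfl) x
  have ex'₃ := fun x => ModuleCat.exact_apply_eq_zero_iff (hcol'.homology_exact₃ 1 2 rfl) x
  have exc := fun n x => ModuleCat.exact_apply_eq_zero_iff (hcol.homology_exact₂ n) x
  have exc₁ := fun x => ModuleCat.exact_apply_eq_zero_iff (hcol.homology_exact₁ 0 1 rfl) x
  have exc₃ := fun x => ModuleCat.exact_apply_eq_zero_iff (hcol.homology_exact₃ 0 1 rfl) x
  have exQ₃ := fun x => ModuleCat.exact_apply_eq_zero_iff (hcolQ.homology_exact₃ 0 1 rfl) x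
  have natCol := fun x => ModuleCat.apply_apply_eq_of_comp_eq
    (HomologySequence.δ_naturality
      (ShortComplex.Hom.mk (S₁ := .mk u v wcol) (S₂ := .mk r s wcolQ) b₁ b₂ b₃ hsq₃ hsq₄)
      hcol hcolQ 0 1 rfl) x
  have natRow := fun x => ModuleCat.apply_apply_eq_of_comp_eq
    (HomologySequence.δ_naturality
      (ShortComplex.Hom.mk (S₁ := .mk a₂ b₂ wrow₂) (S₂ := .mk a₃ b₃ wrow₃) q v s
        hsq₂.symm hsq₄.symm)
      hrow₂ hrow₃ 0 1 rfl) x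
  dsimp only at ex₁ exδ₃ exδ₂ ex' ex'₁ ex'₃ exc exc₁ exc₃ exQ₃ natCol natRow
  -- the kernel of `g₃` lifts to the kernel of `g₂`, by surjectivity of `H⁰(Q₂) → H⁰(Q₃)`
  have lift_ker : ∀ y : C'₃.homology 1, homologyMap a₃ 1 y = 0 →
      ∃ y₂ : C'₂.homology 1, homologyMap a₂ 1 y₂ = 0 ∧ homologyMap q 1 y₂ = y := by
    intro y hy
    obtain ⟨t, rfl⟩ := (exδ₃ y).1 hy
    obtain ⟨t', rfl⟩ := hsurj t
    exact ⟨hrow₂.δ 0 1 rfl t', (exδ₂ _).2 ⟨t', rfl⟩, natRow t'⟩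
  have wd : ∀ y y' : C'₃.homology 1, homologyMap a₃ 1 y = homologyMap a₃ 1 y' →
      (hcol'.δ 1 2 rfl) y = (hcol'.δ 1 2 rfl) y' := by
    intro y y' h
    obtain ⟨y₂, -, hy₂⟩ := lift_ker (y - y') (by rw [map_sub, h, sub_self])
    rw [← sub_eq_zero, ← map_sub]
    exact (ex'₃ _).2 ⟨y₂, hy₂⟩
  refine ⟨?_, ?_, ?_, wd, exc 0, exc₃, fun x _ => exc₁ x, ?_, ?_, ex'₁, ex' 2⟩
  · rintro _ ⟨y, rfl⟩
    exact ⟨homologyMap p 1 y, (hau 1 y).symm⟩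
  · rintro _ ⟨y, rfl⟩
    exact ⟨homologyMap q 1 y, (hav 1 y).symm⟩
  · intro x
    exact (ex₁ _).1 ((natCol x).trans ((exQ₃ _).2 (hsurj _)))
  · rintro _ ⟨y, rfl⟩
    constructor
    · intro h
      rw [hav] at h
      obtain ⟨y₂, hy₂, hqy₂⟩ := lift_ker _ h
      obtain ⟨w, hw⟩ := (ex' 1 (y - y₂)).1 (by rw [map_sub, hqy₂, sub_self])
      exact ⟨_, ⟨w, rfl⟩, by rw [hau, hw, map_sub, hy₂, sub_zero]⟩
    · rintro ⟨w, -, hw⟩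
      exact (exc 1 _).2 ⟨w, hw⟩
  · intro y
    constructor
    · intro h
      obtain ⟨y₂, rfl⟩ := (ex'₃ y).1 h
      exact ⟨_, ⟨y₂, rfl⟩, hav 1 y₂⟩
    · rintro ⟨_, ⟨y₂, rfl⟩, h⟩
      rw [hav] at h
      rw [← wd _ _ h]
      exact (ex'₃ _).2 ⟨y₂, rfl⟩
end

section
/- Under the surjectivity assumption on H^0(Q_2) → H^0(Q_3), the sequence S_1 → S_2 → S_3 is exact at S_2: if x ∈ S_2 maps to 0 in H^1(C_3), then x lies in the image of S_1 under the map H^1(C_1) → H^1(C_2). (This is the abstract homological form of the exactness step at H^1_{g,J}(W_2) in the proof of Theorem 3.3 of the paper.) -/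
open CategoryTheory HomologicalComplex

/-- Abstract homological form of the exactness step at `H¹_{g,J}(W₂)` in Theorem 3.3: the
sequence `S₁ → S₂ → S₃` is exact at `S₂`; in particular if `x ∈ S₂` maps to `0` in `H¹(C₃)`
then `x` lies in the image of `S₁` under `H¹(C₁) → H¹(C₂)`. -/
theorem stmt3 {R : Type} [CommRing R]
    (C'₁ C'₂ C'₃ C₁ C₂ C₃ Q₁ Q₂ Q₃ : CochainComplex (ModuleCat R) ℕ)
    (a₁ : C'₁ ⟶ C₁) (a₂ : C'₂ ⟶ C₂) (a₃ : C'₃ ⟶ C₃)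
    (b₁ : C₁ ⟶ Q₁) (b₂ : C₂ ⟶ Q₂) (b₃ : C₃ ⟶ Q₃)
    (p : C'₁ ⟶ C'₂) (q : C'₂ ⟶ C'₃)
    (u : C₁ ⟶ C₂) (v : C₂ ⟶ C₃)
    (r : Q₁ ⟶ Q₂) (s : Q₂ ⟶ Q₃)
    (wrow₁ : a₁ ≫ b₁ = 0) (wrow₂ : a₂ ≫ b₂ = 0) (wrow₃ : a₃ ≫ b₃ = 0)
    (hrow₁ : (ShortComplex.mk a₁ b₁ wrow₁).ShortExact)
    (hrow₂ : (ShortComplex.mk a₂ b₂ wrow₂).ShortExact)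
    (hrow₃ : (ShortComplex.mk a₃ b₃ wrow₃).ShortExact)
    (wcol' : p ≫ q = 0) (wcol : u ≫ v = 0) (wcolQ : r ≫ s = 0)
    (hcol' : (ShortComplex.mk p q wcol').ShortExact)
    (hcol : (ShortComplex.mk u v wcol).ShortExact)
    (hcolQ : (ShortComplex.mk r s wcolQ).ShortExact)
    (hsq₁ : a₁ ≫ u = p ≫ a₂) (hsq₂ : a₂ ≫ v = q ≫ a₃)
    (hsq₃ : b₁ ≫ r = u ≫ b₂) (hsq₄ : b₂ ≫ s = v ≫ b₃)
    (hsurj : Function.Surjective ⇑(homologyMap s 0)) :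
    ∀ x ∈ Set.range ⇑(homologyMap a₂ 1),
      (homologyMap v 1 x = 0 ↔ ∃ w ∈ Set.range ⇑(homologyMap a₁ 1), homologyMap u 1 w = x) := by
  rintro _ ⟨y, rfl⟩
  have sq₁ := fun w ↦ ConcreteCategory.congr_hom
    ((homologyMap_comp a₁ u 1).symm.trans
      ((congrArg (homologyMap · 1) hsq₁).trans (homologyMap_comp p a₂ 1))) w
  have sq₂ := fun w ↦ ConcreteCategory.congr_hom
    ((homologyMap_comp a₂ v 1).symm.trans
      ((congrArg (homologyMap · 1) hsq₂).trans (homologyMap_comp q a₃ 1))) w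
  simp only [ConcreteCategory.comp_apply] at sq₁ sq₂
  constructor
  · intro hy
    have hδ : ∀ z, hrow₃.δ 0 1 rfl (homologyMap s 0 z) =
        homologyMap q 1 (hrow₂.δ 0 1 rfl z) := fun z ↦ by
      have h := HomologySequence.δ_naturality
        (ShortComplex.homMk (S₁ := ShortComplex.mk a₂ b₂ wrow₂)
          (S₂ := ShortComplex.mk a₃ b₃ wrow₃) q v s hsq₂.symm hsq₄.symm) hrow₂ hrow₃ 0 1 rfl
      exact (ConcreteCategory.congr_hom h z).symm
    obtain ⟨z₃, hz₃⟩ := (ShortComplex.moduleCat_exact_iff _).1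
      (hrow₃.homology_exact₁ 0 1 rfl) (homologyMap q 1 y) ((sq₂ y).symm.trans hy)
    obtain ⟨z, rfl⟩ := hsurj z₃
    obtain ⟨y₁, hy₁⟩ := (ShortComplex.moduleCat_exact_iff _).1
      (hcol'.homology_exact₂ 1) (y - hrow₂.δ 0 1 rfl z) (by
        change homologyMap q 1 _ = 0
        rw [map_sub, sub_eq_zero, ← hδ]
        exact hz₃.symm)
    have hδa : homologyMap a₂ 1 (hrow₂.δ 0 1 rfl z) = 0 :=
      ConcreteCategory.congr_hom (hrow₂.δ_comp 0 1 rfl) z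
    refine ⟨_, ⟨y₁, rfl⟩, (sq₁ y₁).trans ?_⟩
    refine (congrArg (homologyMap a₂ 1) hy₁).trans ?_
    rw [map_sub, hδa, sub_zero]
  · rintro ⟨w, -, hw⟩
    rw [← hw, ← ConcreteCategory.comp_apply, ← homologyMap_comp, wcol, homologyMap_zero]
    rfl
end

section
/- Under the surjectivity assumption on H^0(Q_2) → H^0(Q_3), the sequence S_3 →^{∂¹} H^2(C'_1) → H^2(C'_2) is exact at H^2(C'_1): the image of the well-defined map ∂¹ (sending g_3(y) to the image of y under the connecting homomorphism H^1(C'_3) → H^2(C'_1) of the first column) equals the kernel of the induced map H^2(C'_1) → H^2(C'_2). (This is the abstract homological form of the exactness step at H^2(W_1(δ)) in the proof of Theorem 3.3 of the paper.) -/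
open CategoryTheory HomologicalComplex

/-- Abstract homological form of the exactness step at `H²(W₁(δ))` in Theorem 3.3: the image
of `∂¹ : S₃ → H²(C'₁)` (which sends `g₃ y` to the image of `y` under the connecting map
`H¹(C'₃) → H²(C'₁)` of the first column, and hence has image equal to the range of that
connecting map, `g₃` surjecting onto `S₃`) equals the kernel of `H²(C'₁) → H²(C'₂)`.
We also record the well-definedness of `∂¹`. -/
theorem stmt4 {R : Type} [CommRing R]
    (C'₁ C'₂ C'₃ C₁ C₂ C₃ Q₁ Q₂ Q₃ : CochainComplex (ModuleCat R) ℕ)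
    (a₁ : C'₁ ⟶ C₁) (a₂ : C'₂ ⟶ C₂) (a₃ : C'₃ ⟶ C₃)
    (b₁ : C₁ ⟶ Q₁) (b₂ : C₂ ⟶ Q₂) (b₃ : C₃ ⟶ Q₃)
    (p : C'₁ ⟶ C'₂) (q : C'₂ ⟶ C'₃)
    (u : C₁ ⟶ C₂) (v : C₂ ⟶ C₃)
    (r : Q₁ ⟶ Q₂) (s : Q₂ ⟶ Q₃)
    (wrow₁ : a₁ ≫ b₁ = 0) (wrow₂ : a₂ ≫ b₂ = 0) (wrow₃ : a₃ ≫ b₃ = 0)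
    (hrow₁ : (ShortComplex.mk a₁ b₁ wrow₁).ShortExact)
    (hrow₂ : (ShortComplex.mk a₂ b₂ wrow₂).ShortExact)
    (hrow₃ : (ShortComplex.mk a₃ b₃ wrow₃).ShortExact)
    (wcol' : p ≫ q = 0) (wcol : u ≫ v = 0) (wcolQ : r ≫ s = 0)
    (hcol' : (ShortComplex.mk p q wcol').ShortExact)
    (hcol : (ShortComplex.mk u v wcol).ShortExact)
    (hcolQ : (ShortComplex.mk r s wcolQ).ShortExact)
    (hsq₁ : a₁ ≫ u = p ≫ a₂) (hsq₂ : a₂ ≫ v = q ≫ a₃)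
    (hsq₃ : b₁ ≫ r = u ≫ b₂) (hsq₄ : b₂ ≫ s = v ≫ b₃)
    (hsurj : Function.Surjective ⇑(homologyMap s 0)) :
    -- ∂¹ is well-defined on S₃
    (∀ y y' : C'₃.homology 1, homologyMap a₃ 1 y = homologyMap a₃ 1 y' →
      (hcol'.δ 1 2 rfl) y = (hcol'.δ 1 2 rfl) y') ∧
    -- image of ∂¹ equals the kernel of H²(C'₁) → H²(C'₂)
    (∀ z : C'₁.homology 2,
      ((∃ y : C'₃.homology 1, (hcol'.δ 1 2 rfl) y = z) ↔ homologyMap p 2 z = 0)) := by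
  have δ_comp_q (w : Q₂.homology 0) :
      hrow₃.δ 0 1 rfl (homologyMap s 0 w) = homologyMap q 1 (hrow₂.δ 0 1 rfl w) := by
    let φ : ShortComplex.mk a₂ b₂ wrow₂ ⟶ ShortComplex.mk a₃ b₃ wrow₃ :=
      { τ₁ := q, τ₂ := v, τ₃ := s, comm₁₂ := hsq₂.symm, comm₂₃ := hsq₄.symm }
    exact (ConcreteCategory.congr_hom
      (HomologySequence.δ_naturality φ hrow₂ hrow₃ 0 1 rfl) w).symm
  have q_comp_δ (x : C'₂.homology 1) : hcol'.δ 1 2 rfl (homologyMap q 1 x) = 0 :=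
    ConcreteCategory.congr_hom (hcol'.comp_δ 1 2 rfl) x
  refine ⟨fun y y' h ↦ ?_, fun z ↦ ⟨?_, fun hz ↦ ?_⟩⟩
  · obtain ⟨t, ht⟩ := (ShortComplex.moduleCat_exact_iff _).1
      (hrow₃.homology_exact₁ 0 1 rfl) (y - y') ((map_sub _ y y').trans (sub_eq_zero.2 h))
    obtain ⟨w, rfl⟩ := hsurj t
    rw [← sub_eq_zero, ← map_sub]
    exact (congrArg (hcol'.δ 1 2 rfl) (ht.symm.trans (δ_comp_q w))).trans (q_comp_δ _)
  · rintro ⟨y, rfl⟩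
    exact ConcreteCategory.congr_hom (hcol'.δ_comp 1 2 rfl) y
  · exact (ShortComplex.moduleCat_exact_iff _).1 (hcol'.homology_exact₁ 1 2 rfl) z hz
end
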